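/- Let H be a fixed graph on r vertices and let p_0 = (ln n − 2 ln ln n)/m_1(H). Then with probability tending to 1 as n → ∞, every subset S of LARGE with |S| ≤ n/(30r) satisfies |N(S)| ≥ 10|S|, where N(S) is the external neighborhood of S in G(H,n,p_0). -/

import Mathlib

open Filter

namespace RandomMotif

/-- `G` is a *copy* of `H` in the complete graph on `Fin n`: the image of `H`
under an injection of its vertices into `Fin n`. -/
def IsCopy {k n : ℕ} (H : SimpleGraph (Fin k)) (G : SimpleGraph (Fin n)) : Prop :=
  ∃ f : Fin k ↪ Fin n, G = H.map f

/-- The type of copies of `H` in `K_n`. -/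
abbrev Copy {k : ℕ} (H : SimpleGraph (Fin k)) (n : ℕ) : Type :=
  {G : SimpleGraph (Fin n) // IsCopy H G}

/-- The graph spanned by the selected copies. -/
noncomputable def graphOf {k n : ℕ} {H : SimpleGraph (Fin k)} (ω : Copy H n → Bool) :
    SimpleGraph (Fin n) :=
  ⨆ c : Copy H n, if ω c then c.1 else ⊥

open Classical in
/-- The probability, in the binomial random motif model `G(H,n,p)` (each copy of `H`
in `K_n` is included independently with probability `p`), of the event `P` on the
family of selected copies. -/
noncomputable def selProb {k : ℕ} (H : SimpleGraph (Fin k)) (n : ℕ) (p : ℝ)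
    (P : (Copy H n → Bool) → Prop) : ℝ :=
  ∑ ω : Copy H n → Bool,
    (∏ c : Copy H n, if ω c then p else 1 - p) * (if P ω then 1 else 0)

/-- The probability that `G(H,n,p)` satisfies the graph predicate `Q`. -/
noncomputable def motifProb {k : ℕ} (H : SimpleGraph (Fin k)) (n : ℕ) (p : ℝ)
    (Q : SimpleGraph (Fin n) → Prop) : ℝ :=
  selProb H n p (fun ω => Q (graphOf ω))

/-- `mr H n r` is the number of copies of `H` in `K_n` whose vertex set meets
`[r] = {0,…,r-1}`. -/
noncomputable def mr {k : ℕ} (H : SimpleGraph (Fin k)) (n r : ℕ) : ℕ :=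
  Nat.card {G : SimpleGraph (Fin n) // IsCopy H G ∧ ∃ v ∈ G.support, (v : ℕ) < r}

/-- The minimum degree `δ(H)`. -/
noncomputable def minDeg {k : ℕ} (H : SimpleGraph (Fin k)) : ℕ :=
  ⨅ v, (H.neighborSet v).ncard

/-- `δ_d(H) = ⌈d / δ(H)⌉ - 1`. -/
noncomputable def deltad {k : ℕ} (H : SimpleGraph (Fin k)) (d : ℕ) : ℕ :=
  ⌈(d : ℝ) / (minDeg H : ℝ)⌉₊ - 1

/-- `p_d^-(H) = (ln n + δ_d(H) ln ln n - x(n)) / m_1(H)`, where `x` is a fixed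
function with `1 ≪ x(n) ≪ ln ln n`. -/
noncomputable def pMinus {k : ℕ} (H : SimpleGraph (Fin k)) (d : ℕ) (x : ℕ → ℝ) (n : ℕ) : ℝ :=
  (Real.log n + (deltad H d) * Real.log (Real.log n) - x n) / (mr H n 1)

/-- `p_d^+(H) = (ln n + δ_d(H) ln ln n + x(n)) / m_1(H)`, where `x` is a fixed
function with `1 ≪ x(n) ≪ ln ln n`. -/
noncomputable def pPlus {k : ℕ} (H : SimpleGraph (Fin k)) (d : ℕ) (x : ℕ → ℝ) (n : ℕ) : ℝ :=
  (Real.log n + (deltad H d) * Real.log (Real.log n) + x n) / (mr H n 1)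

/-- The number of selected copies of `H` containing the vertex `v`. -/
noncomputable def copyCount {k n : ℕ} {H : SimpleGraph (Fin k)}
    (ω : Copy H n → Bool) (v : Fin n) : ℕ :=
  Nat.card {c : Copy H n // ω c = true ∧ v ∈ c.1.support}

/-- `SMALL`: the set of vertices lying on fewer than `ln ln n` of the selected
copies of `H`. -/
noncomputable def Small {k n : ℕ} {H : SimpleGraph (Fin k)}
    (ω : Copy H n → Bool) : Set (Fin n) :=
  {v : Fin n | (copyCount ω v : ℝ) < Real.log (Real.log n)}

/-- `LARGE`: the set of vertices lying on at least `ln ln n` of the selected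
copies of `H`. -/
noncomputable def Large {k n : ℕ} {H : SimpleGraph (Fin k)}
    (ω : Copy H n → Bool) : Set (Fin n) :=
  {v : Fin n | Real.log (Real.log n) ≤ (copyCount ω v : ℝ)}

/-- `p_0 = (ln n - 2 ln ln n) / m_1(H)`. -/
noncomputable def pZero {k : ℕ} (H : SimpleGraph (Fin k)) (n : ℕ) : ℝ :=
  (Real.log n - 2 * Real.log (Real.log n)) / (mr H n 1)

/-- The external neighbourhood of a vertex set. -/
def extNbhd {n : ℕ} (G : SimpleGraph (Fin n)) (S : Set (Fin n)) : Set (Fin n) :=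
  {w : Fin n | w ∉ S ∧ ∃ u ∈ S, G.Adj u w}

section Probability

lemma sum_prod_bool {ι : Type*} [Fintype ι] [DecidableEq ι] (g : ι → Bool → ℝ) :
    ∑ ω : ι → Bool, ∏ c, g c (ω c) = ∏ c, (g c true + g c false) := by
  have h := Finset.prod_univ_sum (fun _ : ι => (Finset.univ : Finset Bool)) g
  rw [Fintype.piFinset_univ] at h
  rw [← h]
  simp

variable {k n : ℕ} {H : SimpleGraph (Fin k)} {p : ℝ}

lemma weight_nonneg (hp0 : 0 ≤ p) (hp1 : p ≤ 1) {ι : Type*} [Fintype ι] (ω : ι → Bool) :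
    0 ≤ ∏ c, (if ω c then p else 1 - p) :=
  Finset.prod_nonneg fun c _ => by split_ifs <;> linarith

lemma selProb_mono (hp0 : 0 ≤ p) (hp1 : p ≤ 1) {P Q : (Copy H n → Bool) → Prop}
    (h : ∀ ω, P ω → Q ω) : selProb H n p P ≤ selProb H n p Q := by
  classical
  unfold selProb
  refine Finset.sum_le_sum fun ω _ =>
    mul_le_mul_of_nonneg_left ?_ (weight_nonneg hp0 hp1 ω)
  by_cases hP : P ω
  · simp [hP, h ω hP]
  · rw [if_neg hP]
    split_ifs <;> norm_num

lemma selProb_exists_le (hp0 : 0 ≤ p) (hp1 : p ≤ 1) {ι : Type*} (s : Finset ι)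
    (P : ι → (Copy H n → Bool) → Prop) :
    selProb H n p (fun ω => ∃ i ∈ s, P i ω) ≤ ∑ i ∈ s, selProb H n p (P i) := by
  classical
  unfold selProb
  rw [Finset.sum_comm]
  refine Finset.sum_le_sum fun ω _ => ?_
  rw [← Finset.mul_sum]
  refine mul_le_mul_of_nonneg_left ?_ (weight_nonneg hp0 hp1 ω)
  have h0 : ∀ i ∈ s, (0 : ℝ) ≤ if P i ω then 1 else 0 := fun i _ => by split_ifs <;> norm_num
  split_ifs with h
  · obtain ⟨i, hi, hP⟩ := h
    calc (1 : ℝ) = if P i ω then 1 else 0 := by simp [hP]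
      _ ≤ _ := Finset.single_le_sum (f := fun i => if P i ω then (1 : ℝ) else 0) h0 hi
  · exact Finset.sum_nonneg h0

lemma selProb_eq_one_sub (P : (Copy H n → Bool) → Prop) :
    selProb H n p P = 1 - selProb H n p (fun ω => ¬ P ω) := by
  classical
  have h1 : ∑ ω : Copy H n → Bool, ∏ c : Copy H n, (if ω c then p else 1 - p) = 1 := by
    have h := sum_prod_bool (ι := Copy H n) fun _ b => if b then p else 1 - p
    simp only [if_true, Bool.false_eq_true, if_false, add_sub_cancel,
      Finset.prod_const_one] at h
    convert h
  rw [eq_sub_iff_add_eq, ← h1]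
  unfold selProb
  rw [← Finset.sum_add_distrib]
  refine Finset.sum_congr rfl fun ω _ => ?_
  by_cases h : P ω <;> simp [h]

lemma sum_weight_mul_forall_eq {ι : Type*} [Fintype ι] [DecidableEq ι] (p : ℝ) (b : Bool)
    (A : Finset ι) : ∑ ω : ι → Bool, (∏ c, if ω c then p else 1 - p) *
      (if ∀ c ∈ A, ω c = b then 1 else 0) = (if b then p else 1 - p) ^ A.card := by
  have h := sum_prod_bool fun (c : ι) x =>
    (if x then p else 1 - p) * if c ∈ A → x = b then 1 else 0
  have h2 : ∏ c : ι, (((if true then p else 1 - p) * if c ∈ A → true = b then 1 else 0) +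
      ((if false then p else 1 - p) * if c ∈ A → false = b then 1 else 0)) =
      (if b then p else 1 - p) ^ A.card := by
    rw [← Finset.prod_const, ← Finset.prod_subset (Finset.subset_univ A)]
    · refine Finset.prod_congr rfl fun c hc => ?_
      cases b <;> simp [hc]
    · intro c _ hc
      simp [hc]
  rw [← h2, ← h]
  refine Finset.sum_congr rfl fun ω _ => ?_
  rw [Finset.prod_mul_distrib, Finset.prod_boole]
  simp

lemma selProb_forall_eq (b : Bool) (A : Finset (Copy H n)) :
    selProb H n p (fun ω => ∀ c ∈ A, ω c = b) = (if b then p else 1 - p) ^ A.card := by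
  classical
  rw [← sum_weight_mul_forall_eq p b A]
  unfold selProb
  congr!

end Probability

section Counting

variable {k n : ℕ} {H : SimpleGraph (Fin k)}

/-- The action of a permutation of the vertices of `K_n` on the copies of `H`. -/
def permCopy (H : SimpleGraph (Fin k)) (σ : Equiv.Perm (Fin n)) (c : Copy H n) : Copy H n :=
  ⟨c.1.map σ.toEmbedding, by
    obtain ⟨f, hf⟩ := c.2
    exact ⟨f.trans σ.toEmbedding, by rw [hf, SimpleGraph.map_map]; rfl⟩⟩

lemma permCopy_adj (σ : Equiv.Perm (Fin n)) (c : Copy H n) (u v : Fin n) :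
    (permCopy H σ c).1.Adj (σ u) (σ v) ↔ c.1.Adj u v :=
  SimpleGraph.map_adj_apply (f := σ.toEmbedding)

lemma permCopy_mem_support (σ : Equiv.Perm (Fin n)) (c : Copy H n) (u : Fin n) :
    σ u ∈ (permCopy H σ c).1.support ↔ u ∈ c.1.support := by
  simp only [SimpleGraph.mem_support]
  constructor
  · rintro ⟨w, hw⟩
    refine ⟨σ.symm w, (permCopy_adj σ c _ _).1 ?_⟩
    simpa using hw
  · rintro ⟨w, hw⟩
    exact ⟨σ w, (permCopy_adj σ c _ _).2 hw⟩

lemma permCopy_injective (σ : Equiv.Perm (Fin n)) : Function.Injective (permCopy H σ) :=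
  fun _ _ h => Subtype.ext (SimpleGraph.map_injective σ.toEmbedding (congrArg Subtype.val h))

open Classical in
/-- The copies of `H` in `K_n` containing the vertex `u`. -/
noncomputable def copiesAt (H : SimpleGraph (Fin k)) (u : Fin n) : Finset (Copy H n) :=
  Finset.univ.filter fun c => u ∈ c.1.support

open Classical in
/-- The copies of `H` in `K_n` containing the edge `uw`. -/
noncomputable def copiesEdge (H : SimpleGraph (Fin k)) (u w : Fin n) : Finset (Copy H n) :=
  Finset.univ.filter fun c => c.1.Adj u w

open Classical in
/-- The copies of `H` in `K_n` containing both vertices `u` and `w`. -/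
noncomputable def copiesPair (H : SimpleGraph (Fin k)) (u w : Fin n) : Finset (Copy H n) :=
  Finset.univ.filter fun c => u ∈ c.1.support ∧ w ∈ c.1.support

lemma mem_copiesAt {u : Fin n} {c : Copy H n} : c ∈ copiesAt H u ↔ u ∈ c.1.support := by
  simp [copiesAt]

lemma mem_copiesEdge {u w : Fin n} {c : Copy H n} : c ∈ copiesEdge H u w ↔ c.1.Adj u w := by
  simp [copiesEdge]

lemma mem_copiesPair {u w : Fin n} {c : Copy H n} :
    c ∈ copiesPair H u w ↔ u ∈ c.1.support ∧ w ∈ c.1.support := by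
  simp [copiesPair]

lemma card_copiesAt_le (σ : Equiv.Perm (Fin n)) (u : Fin n) :
    (copiesAt H u).card ≤ (copiesAt H (σ u)).card :=
  Finset.card_le_card_of_injOn (permCopy H σ)
    (fun c hc => mem_copiesAt.2 ((permCopy_mem_support σ c u).2 (mem_copiesAt.1 hc)))
    (permCopy_injective σ).injOn

lemma card_copiesEdge_le (σ : Equiv.Perm (Fin n)) (u w : Fin n) :
    (copiesEdge H u w).card ≤ (copiesEdge H (σ u) (σ w)).card :=
  Finset.card_le_card_of_injOn (permCopy H σ)
    (fun c hc => mem_copiesEdge.2 ((permCopy_adj σ c u w).2 (mem_copiesEdge.1 hc)))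
    (permCopy_injective σ).injOn

lemma card_copiesPair_le (σ : Equiv.Perm (Fin n)) (u w : Fin n) :
    (copiesPair H u w).card ≤ (copiesPair H (σ u) (σ w)).card :=
  Finset.card_le_card_of_injOn (permCopy H σ)
    (fun c hc => mem_copiesPair.2 ⟨(permCopy_mem_support σ c u).2 (mem_copiesPair.1 hc).1,
      (permCopy_mem_support σ c w).2 (mem_copiesPair.1 hc).2⟩)
    (permCopy_injective σ).injOn

lemma card_copiesAt (u v : Fin n) : (copiesAt H u).card = (copiesAt H v).card := by
  have key : ∀ u v : Fin n, (copiesAt H u).card ≤ (copiesAt H v).card := fun u v => by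
    simpa using card_copiesAt_le (H := H) (Equiv.swap u v) u
  exact le_antisymm (key u v) (key v u)

lemma card_copiesEdge_le_of_ne {u w w' : Fin n} (hw : u ≠ w) (hw' : u ≠ w') :
    (copiesEdge H u w).card ≤ (copiesEdge H u w').card := by
  simpa [Equiv.swap_apply_of_ne_of_ne hw hw'] using
    card_copiesEdge_le (H := H) (Equiv.swap w w') u w

lemma card_copiesPair_le_of_ne {u w w' : Fin n} (hw : u ≠ w) (hw' : u ≠ w') :
    (copiesPair H u w).card ≤ (copiesPair H u w').card := by
  simpa [Equiv.swap_apply_of_ne_of_ne hw hw'] using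
    card_copiesPair_le (H := H) (Equiv.swap w w') u w

lemma card_copiesAt_eq_mr (u : Fin n) : (copiesAt H u).card = mr H n 1 := by
  classical
  have h0 : 0 < n := u.pos
  rw [card_copiesAt u ⟨0, h0⟩, mr,
    ← Nat.card_congr (Equiv.subtypeSubtypeEquivSubtypeInter (IsCopy H)
      (fun G : SimpleGraph (Fin n) => ∃ v ∈ G.support, (v : ℕ) < 1)),
    ← Nat.card_eq_finsetCard]
  refine Nat.card_congr (Equiv.subtypeEquivRight fun c => ?_)
  rw [mem_copiesAt]
  constructor
  · exact fun h => ⟨_, h, Nat.zero_lt_one⟩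
  · rintro ⟨v, hv, hv0⟩
    rwa [show (⟨0, h0⟩ : Fin n) = v from Fin.ext (by simp; omega)]

open Classical in
lemma card_support_le (c : Copy H n) :
    (Finset.univ.filter fun v => v ∈ c.1.support).card ≤ k := by
  obtain ⟨f, hf⟩ := c.2
  calc _ ≤ (Finset.univ.image f).card := by
        refine Finset.card_le_card fun v hv => ?_
        simp only [Finset.mem_filter, Finset.mem_univ, true_and, hf, SimpleGraph.support_map] at hv
        obtain ⟨a, _, ha⟩ := hv
        exact Finset.mem_image.2 ⟨a, Finset.mem_univ _, ha⟩
    _ ≤ _ := Finset.card_image_le.trans (by simp)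

open Classical in
lemma sum_card_filter_mem_support_le (A : Finset (Copy H n)) (S : Finset (Fin n)) :
    ∑ v ∈ S, (A.filter fun c => v ∈ c.1.support).card ≤ k * A.card := by
  have h := Finset.sum_card_bipartiteAbove_eq_sum_card_bipartiteBelow (s := S) (t := A)
    (fun v (c : Copy H n) => v ∈ c.1.support)
  simp only [Finset.bipartiteAbove] at h
  rw [h, mul_comm]
  refine Finset.sum_le_card_nsmul _ _ _ fun c _ => ?_
  exact (Finset.card_le_card (Finset.filter_subset_filter _ (Finset.subset_univ S))).trans
    (card_support_le c)

lemma mul_card_copiesPair_le {u w : Fin n} (huw : u ≠ w) :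
    (n - 1) * (copiesPair H u w).card ≤ k * mr H n 1 := by
  classical
  calc (n - 1) * (copiesPair H u w).card
      = ∑ w' ∈ Finset.univ.erase u, (copiesPair H u w).card := by simp
    _ ≤ ∑ w' ∈ Finset.univ.erase u, (copiesPair H u w').card :=
        Finset.sum_le_sum fun w' hw' =>
          card_copiesPair_le_of_ne huw (Finset.ne_of_mem_erase hw').symm
    _ = ∑ w' ∈ Finset.univ.erase u, ((copiesAt H u).filter fun c => w' ∈ c.1.support).card := by
        refine Finset.sum_congr rfl fun w' _ => congrArg _ ?_
        ext c; simp [mem_copiesAt, mem_copiesPair]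
    _ ≤ k * (copiesAt H u).card := sum_card_filter_mem_support_le _ _
    _ = _ := by rw [card_copiesAt_eq_mr]

lemma mr_le_mul_card_copiesEdge {u w : Fin n} (huw : u ≠ w) :
    mr H n 1 ≤ (n - 1) * (copiesEdge H u w).card := by
  classical
  calc mr H n 1 = (copiesAt H u).card := (card_copiesAt_eq_mr u).symm
    _ ≤ ((Finset.univ.erase u).biUnion fun w' => copiesEdge H u w').card := by
        refine Finset.card_le_card fun c hc => ?_
        obtain ⟨w', hw'⟩ := mem_copiesAt.1 hc
        exact Finset.mem_biUnion.2 ⟨w', by simp [hw'.ne'], mem_copiesEdge.2 hw'⟩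
    _ ≤ ∑ w' ∈ Finset.univ.erase u, (copiesEdge H u w').card := Finset.card_biUnion_le
    _ ≤ ∑ w' ∈ Finset.univ.erase u, (copiesEdge H u w).card :=
        Finset.sum_le_sum fun w' hw' =>
          card_copiesEdge_le_of_ne (Finset.ne_of_mem_erase hw').symm huw
    _ = _ := by simp

lemma mr_pos (hk : 0 < k) (hiso : ∀ v, (H.neighborSet v).Nonempty) (hkn : k ≤ n) :
    0 < mr H n 1 := by
  rw [← card_copiesAt_eq_mr (Fin.castLEEmb hkn ⟨0, hk⟩)]
  obtain ⟨w, hw⟩ := hiso ⟨0, hk⟩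
  refine Finset.card_pos.2 ⟨⟨H.map (Fin.castLEEmb hkn), _, rfl⟩, mem_copiesAt.2 ?_⟩
  exact ⟨Fin.castLEEmb hkn w, SimpleGraph.map_adj_apply.2 hw⟩

lemma le_mul_mr (hk : 0 < k) (hiso : ∀ v, (H.neighborSet v).Nonempty) (hkn : k ≤ n)
    (hn : 2 ≤ n) : n - 1 ≤ k * mr H n 1 := by
  have huw : (⟨0, by omega⟩ : Fin n) ≠ ⟨1, by omega⟩ := by simp
  have h1 := (mr_pos hk hiso hkn).trans_le (mr_le_mul_card_copiesEdge (H := H) huw)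
  have h2 : copiesEdge H (⟨0, by omega⟩ : Fin n) ⟨1, by omega⟩ ⊆ copiesPair H _ _ := fun c hc =>
    mem_copiesPair.2 ⟨(mem_copiesEdge.1 hc).left_mem_support,
      (mem_copiesEdge.1 hc).right_mem_support⟩
  refine le_trans ?_ (mul_card_copiesPair_le (H := H) huw)
  refine Nat.le_mul_of_pos_right _ ?_
  exact (Nat.pos_of_mul_pos_left h1).trans_le (Finset.card_le_card h2)

open Classical in
/-- The copies of `H` with an edge between `S` and the complement of `U`. -/
noncomputable def crossing (H : SimpleGraph (Fin k)) (S U : Finset (Fin n)) :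
    Finset (Copy H n) :=
  Finset.univ.filter fun c => ∃ u ∈ S, ∃ w ∉ U, c.1.Adj u w

open Classical in
/-- The copies of `H` with at least two vertices in `U`. -/
noncomputable def meetingTwice (H : SimpleGraph (Fin k)) (U : Finset (Fin n)) :
    Finset (Copy H n) :=
  Finset.univ.filter fun c => ∃ u ∈ U, ∃ w ∈ U, u ≠ w ∧ u ∈ c.1.support ∧ w ∈ c.1.support

lemma mul_card_meetingTwice_le (U : Finset (Fin n)) :
    (n - 1) * (meetingTwice H U).card ≤ U.card ^ 2 * (k * mr H n 1) := by
  classical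
  have h : meetingTwice H U ⊆ U.offDiag.biUnion fun x => copiesPair H x.1 x.2 := by
    intro c hc
    simp only [meetingTwice, Finset.mem_filter, Finset.mem_univ, true_and] at hc
    obtain ⟨u, hu, w, hw, huw, h1, h2⟩ := hc
    exact Finset.mem_biUnion.2 ⟨(u, w), Finset.mem_offDiag.2 ⟨hu, hw, huw⟩,
      mem_copiesPair.2 ⟨h1, h2⟩⟩
  calc (n - 1) * (meetingTwice H U).card
      ≤ (n - 1) * ∑ x ∈ U.offDiag, (copiesPair H x.1 x.2).card :=
        Nat.mul_le_mul_left _ ((Finset.card_le_card h).trans Finset.card_biUnion_le)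
    _ = ∑ x ∈ U.offDiag, (n - 1) * (copiesPair H x.1 x.2).card := Finset.mul_sum _ _ _
    _ ≤ U.offDiag.card * (k * mr H n 1) := by
        rw [← smul_eq_mul]
        exact Finset.sum_le_card_nsmul _ _ _ fun x hx =>
          mul_card_copiesPair_le (Finset.mem_offDiag.1 hx).2.2
    _ ≤ _ := by
        refine Nat.mul_le_mul_right _ ?_
        rw [Finset.offDiag_card, sq]
        exact Nat.sub_le _ _

lemma le_mul_card_crossing {S U : Finset (Fin n)} (hSU : S ⊆ U) :
    S.card * (n - U.card) * mr H n 1 ≤ (n - 1) * (k ^ 2 * (crossing H S U).card) := by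
  classical
  have h := Finset.sum_card_bipartiteAbove_eq_sum_card_bipartiteBelow (s := S ×ˢ Uᶜ)
    (t := crossing H S U) (fun x (c : Copy H n) => c.1.Adj x.1 x.2)
  calc S.card * (n - U.card) * mr H n 1 = ∑ x ∈ S ×ˢ Uᶜ, mr H n 1 := by
        simp [Finset.card_compl]
    _ ≤ ∑ x ∈ S ×ˢ Uᶜ, (n - 1) * (Finset.bipartiteAbove
          (fun x (c : Copy H n) => c.1.Adj x.1 x.2) (crossing H S U) x).card := by
        refine Finset.sum_le_sum fun x hx => ?_
        obtain ⟨hx1, hx2⟩ := Finset.mem_product.1 hx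
        rw [Finset.mem_compl] at hx2
        have hne : x.1 ≠ x.2 := fun he => hx2 (he ▸ hSU hx1)
        refine (mr_le_mul_card_copiesEdge hne).trans
          (Nat.mul_le_mul_left _ (Finset.card_le_card fun c hc => ?_))
        rw [mem_copiesEdge] at hc
        simp only [Finset.bipartiteAbove, crossing, Finset.mem_filter, Finset.mem_univ, true_and]
        exact ⟨⟨_, hx1, _, hx2, hc⟩, hc⟩
    _ ≤ _ := by
        rw [← Finset.mul_sum, h]
        refine Nat.mul_le_mul_left _ ?_
        rw [mul_comm, ← smul_eq_mul]
        refine Finset.sum_le_card_nsmul _ _ _ fun c _ => ?_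
        calc _ ≤ ((Finset.univ.filter fun v => v ∈ c.1.support) ×ˢ
              (Finset.univ.filter fun v => v ∈ c.1.support)).card := by
              refine Finset.card_le_card fun x hx => ?_
              have hadj := (Finset.mem_filter.1 hx).2
              simp [hadj.left_mem_support, hadj.right_mem_support]
          _ ≤ k ^ 2 := by
              rw [Finset.card_product, sq]
              exact Nat.mul_le_mul (card_support_le c) (card_support_le c)

end Counting

section Expansion

variable {k n : ℕ} {H : SimpleGraph (Fin k)}

lemma graphOf_adj {ω : Copy H n → Bool} {u w : Fin n} :
    (graphOf ω).Adj u w ↔ ∃ c, ω c = true ∧ c.1.Adj u w := by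
  simp only [graphOf, SimpleGraph.iSup_adj]
  refine exists_congr fun c => ?_
  by_cases h : ω c = true <;> simp [h]

/-- Some set `S` of size `s` lies in a set `U` of size `11 s` such that no selected copy has an
edge between `S` and the complement of `U`, while at least `24 s` selected copies have two
vertices in `U`. -/
def Bad (H : SimpleGraph (Fin k)) (n s : ℕ) (ω : Copy H n → Bool) : Prop :=
  ∃ U ∈ Finset.powersetCard (11 * s) (Finset.univ : Finset (Fin n)),
    ∃ S ∈ Finset.powersetCard s U, (∀ c ∈ crossing H S U, ω c = false) ∧
      ∃ A ∈ Finset.powersetCard (24 * s) (meetingTwice H U), ∀ c ∈ A, ω c = true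

lemma bad_of_not_expanding (hk : 0 < k) (hL : 24 * (k : ℝ) ≤ Real.log (Real.log n))
    {ω : Copy H n → Bool} {S : Finset (Fin n)} (hS : (S : Set (Fin n)) ⊆ Large ω)
    (hn : 11 * S.card ≤ n) (hN : (extNbhd (graphOf ω) S).ncard < 10 * S.card) :
    Bad H n S.card ω := by
  classical
  obtain ⟨T, hT⟩ : ∃ T : Finset (Fin n), (T : Set (Fin n)) = extNbhd (graphOf ω) S :=
    ⟨_, Set.coe_toFinset _⟩
  rw [← hT, Set.ncard_coe_finset] at hN
  have hcard : (S ∪ T).card ≤ 11 * S.card := (Finset.card_union_le S T).trans (by omega)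
  obtain ⟨U, hU, hUcard⟩ := Finset.exists_superset_card_eq hcard (by simpa using hn)
  have hSU : S ⊆ U := Finset.subset_union_left.trans hU
  have hmem : ∀ c, ω c = true → ∀ u ∈ S, ∀ w, c.1.Adj u w → w ∈ U := by
    intro c hc u hu w hw
    by_cases hwS : w ∈ S
    · exact hSU hwS
    · have : w ∈ (T : Set (Fin n)) := by
        rw [hT]
        exact ⟨hwS, u, hu, graphOf_adj.2 ⟨c, hc, hw⟩⟩
      exact hU (Finset.mem_union_right _ this)
  refine ⟨U, Finset.mem_powersetCard.2 ⟨Finset.subset_univ _, hUcard⟩, S,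
    Finset.mem_powersetCard.2 ⟨hSU, rfl⟩, fun c hc => ?_, ?_⟩
  · simp only [crossing, Finset.mem_filter, Finset.mem_univ, true_and] at hc
    obtain ⟨u, hu, w, hw, hadj⟩ := hc
    by_contra hω
    exact hw (hmem c (by simpa using hω) u hu w hadj)
  · set B := (meetingTwice H U).filter fun c => ω c = true with hB
    have hcount : ∀ v ∈ S, copyCount ω v ≤ (B.filter fun c => v ∈ c.1.support).card := by
      intro v hv
      rw [copyCount, Nat.card_eq_fintype_card, Fintype.card_subtype]
      refine Finset.card_le_card fun c hc => ?_
      obtain ⟨hc1, hc2⟩ := (Finset.mem_filter.1 hc).2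
      obtain ⟨w, hw⟩ := hc2
      simp only [hB, meetingTwice, Finset.mem_filter, Finset.mem_univ, true_and]
      exact ⟨⟨⟨v, hSU hv, w, hmem c hc1 v hv w hw, hw.ne, hw.left_mem_support,
        hw.right_mem_support⟩, hc1⟩, hw.left_mem_support⟩
    have hsum : (S.card : ℝ) * (24 * k) ≤ k * B.card := by
      calc (S.card : ℝ) * (24 * k) = ∑ v ∈ S, (24 * k : ℝ) := by simp
        _ ≤ ∑ v ∈ S, (copyCount ω v : ℝ) := Finset.sum_le_sum fun v hv => hL.trans (hS hv)
        _ ≤ ((∑ v ∈ S, (B.filter fun c => v ∈ c.1.support).card : ℕ) : ℝ) := by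
            push_cast
            exact Finset.sum_le_sum fun v hv => by exact_mod_cast hcount v hv
        _ ≤ k * B.card := by
            have h := sum_card_filter_mem_support_le B S
            exact_mod_cast h
    have hB' : 24 * S.card ≤ B.card := by
      have hk' : (0 : ℝ) < k := by exact_mod_cast hk
      have : (24 * S.card : ℝ) ≤ B.card := le_of_mul_le_mul_left (by linarith) hk'
      exact_mod_cast this
    obtain ⟨A, hA, hAcard⟩ := Finset.exists_subset_card_eq hB'
    exact ⟨A, Finset.mem_powersetCard.2 ⟨hA.trans (Finset.filter_subset _ _), hAcard⟩,
      fun c hc => (Finset.mem_filter.1 (hA hc)).2⟩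

lemma choose_mul_pow_le {M K : ℕ} (hK : 0 < K) {p : ℝ} (hp : 0 ≤ p) :
    (M.choose K : ℝ) * p ^ K ≤ (Real.exp 1 * (M * p) / K) ^ K := by
  have hK' : (0 : ℝ) < K := by exact_mod_cast hK
  have h1 := Nat.choose_le_pow_div (α := ℝ) K M
  have h2 := Real.pow_div_factorial_le_exp (x := (K : ℝ)) hK'.le K
  have hf : (0 : ℝ) < K.factorial := by exact_mod_cast K.factorial_pos
  have h3 : (1 : ℝ) / K.factorial ≤ (Real.exp 1 / K) ^ K := by
    rw [div_pow, ← Real.exp_nat_mul, mul_one, le_div_iff₀ (by positivity)]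
    calc (1 : ℝ) / K.factorial * K ^ K = K ^ K / K.factorial := by ring
      _ ≤ _ := h2
  calc (M.choose K : ℝ) * p ^ K ≤ (M ^ K / K.factorial) * p ^ K := by gcongr
    _ = (M * p) ^ K * (1 / K.factorial) := by rw [mul_pow]; ring
    _ ≤ (M * p) ^ K * (Real.exp 1 / K) ^ K := by gcongr
    _ = _ := by rw [← mul_pow]; congr 1; ring

lemma choose_le_div_pow {s : ℕ} (hs : 0 < s) :
    (n.choose (11 * s) : ℝ) ≤ ((n : ℝ) / s) ^ (11 * s) := by
  have hs' : (0 : ℝ) < s := by exact_mod_cast hs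
  have h := choose_mul_pow_le (M := n) (K := 11 * s) (by omega) (p := 1) zero_le_one
  rw [one_pow, mul_one, mul_one] at h
  refine h.trans (pow_le_pow_left₀ (by positivity) ?_ _)
  push_cast
  rw [div_le_div_iff₀ (by positivity) hs']
  have h3 : Real.exp 1 ≤ 11 := by linarith [Real.exp_one_lt_d9]
  calc Real.exp 1 * n * s ≤ 11 * n * s := by gcongr
    _ = _ := by ring

variable {p : ℝ}

lemma selProb_bad_le_exp (hk : 0 < k) (hp0 : 0 ≤ p) (hp1 : p ≤ 1) {s : ℕ} (hs : 0 < s)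
    (hn : 22 * s ≤ n) :
    selProb H n p (Bad H n s) ≤
      ((n : ℝ) / s) ^ (11 * s) * (2 ^ (11 * s) * Real.exp (-(s * (p * mr H n 1) / (2 * k ^ 2)))) := by
  have hk' : (0 : ℝ) < k := by exact_mod_cast hk
  have hn' : (22 * s : ℝ) ≤ n := by exact_mod_cast hn
  have hs' : (1 : ℝ) ≤ s := by exact_mod_cast hs
  calc selProb H n p (Bad H n s)
      ≤ selProb H n p (fun ω => ∃ U ∈ Finset.powersetCard (11 * s) (Finset.univ : Finset (Fin n)),
          ∃ S ∈ Finset.powersetCard s U, ∀ c ∈ crossing H S U, ω c = false) :=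
        selProb_mono hp0 hp1 fun ω ⟨U, hU, S, hS, h, _⟩ => ⟨U, hU, S, hS, h⟩
    _ ≤ ∑ U ∈ Finset.powersetCard (11 * s) (Finset.univ : Finset (Fin n)),
          ∑ S ∈ Finset.powersetCard s U,
            selProb H n p (fun ω => ∀ c ∈ crossing H S U, ω c = false) :=
        (selProb_exists_le hp0 hp1 _ _).trans
          (Finset.sum_le_sum fun U _ => selProb_exists_le hp0 hp1 _ _)
    _ ≤ ∑ U ∈ Finset.powersetCard (11 * s) (Finset.univ : Finset (Fin n)),
          ∑ S ∈ Finset.powersetCard s U,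
            Real.exp (-(s * (p * mr H n 1) / (2 * k ^ 2))) := by
        refine Finset.sum_le_sum fun U hU => Finset.sum_le_sum fun S hS => ?_
        obtain ⟨-, hU⟩ := Finset.mem_powersetCard.1 hU
        obtain ⟨hSU, hS⟩ := Finset.mem_powersetCard.1 hS
        rw [selProb_forall_eq, if_neg Bool.false_ne_true]
        have hc : (s : ℝ) * mr H n 1 / (2 * k ^ 2) ≤ (crossing H S U).card := by
          have h := le_mul_card_crossing (H := H) hSU
          rw [hS, hU] at h
          have h' : (s : ℝ) * (n - 11 * s) * mr H n 1 ≤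
              (n - 1) * (k ^ 2 * (crossing H S U).card) := by
            have h2 : ((s * (n - 11 * s) * mr H n 1 : ℕ) : ℝ) ≤
              (((n - 1) * (k ^ 2 * (crossing H S U).card) : ℕ) : ℝ) := by exact_mod_cast h
            rw [Nat.cast_mul, Nat.cast_mul, Nat.cast_sub (by omega), Nat.cast_mul (n - 1),
              Nat.cast_sub (by omega)] at h2
            exact_mod_cast h2
          rw [div_le_iff₀ (by positivity)]
          have h3 : (n : ℝ) * (s * mr H n 1) ≤
              n * ((crossing H S U).card * (2 * k ^ 2)) := by
            calc (n : ℝ) * (s * mr H n 1) ≤ (2 * (n - 11 * s)) * (s * mr H n 1) := by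
                  gcongr; linarith
              _ = 2 * (s * (n - 11 * s) * mr H n 1) := by ring
              _ ≤ 2 * ((n - 1) * (k ^ 2 * (crossing H S U).card)) := by gcongr
              _ ≤ 2 * (n * (k ^ 2 * (crossing H S U).card)) := by gcongr; linarith
              _ = _ := by ring
          exact le_of_mul_le_mul_left h3 (by linarith)
        calc (1 - p) ^ (crossing H S U).card ≤ Real.exp (-p) ^ (crossing H S U).card :=
              pow_le_pow_left₀ (by linarith) (by linarith [Real.add_one_le_exp (-p)]) _
          _ = Real.exp (-(p * (crossing H S U).card)) := by
              rw [← Real.exp_nat_mul]; congr 1; ring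
          _ ≤ _ := by
              refine Real.exp_le_exp.2 (neg_le_neg ?_)
              calc _ = p * (s * mr H n 1 / (2 * k ^ 2)) := by ring
                _ ≤ _ := by gcongr
    _ ≤ ∑ U ∈ Finset.powersetCard (11 * s) (Finset.univ : Finset (Fin n)),
          2 ^ (11 * s) * Real.exp (-(s * (p * mr H n 1) / (2 * k ^ 2))) := by
        refine Finset.sum_le_sum fun U hU => ?_
        rw [Finset.sum_const, Finset.card_powersetCard, (Finset.mem_powersetCard.1 hU).2,
          nsmul_eq_mul]
        gcongr
        exact_mod_cast Nat.choose_le_two_pow _ _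
    _ = (n.choose (11 * s)) *
          (2 ^ (11 * s) * Real.exp (-(s * (p * mr H n 1) / (2 * k ^ 2)))) := by
        simp
    _ ≤ _ := by
        gcongr
        exact choose_le_div_pow hs

lemma selProb_bad_le_pow (hp0 : 0 ≤ p) (hp1 : p ≤ 1) {s : ℕ} (hs : 0 < s) (hn : 2 ≤ n) :
    selProb H n p (Bad H n s) ≤
      ((n : ℝ) / s) ^ (11 * s) * (40 * k * (p * mr H n 1) * (s / n)) ^ (24 * s) := by
  have hn' : (2 : ℝ) ≤ n := by exact_mod_cast hn
  have hs' : (1 : ℝ) ≤ s := by exact_mod_cast hs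
  calc selProb H n p (Bad H n s)
      ≤ selProb H n p (fun ω => ∃ U ∈ Finset.powersetCard (11 * s) (Finset.univ : Finset (Fin n)),
          ∃ A ∈ Finset.powersetCard (24 * s) (meetingTwice H U), ∀ c ∈ A, ω c = true) :=
        selProb_mono hp0 hp1 fun ω ⟨U, hU, _, _, _, h⟩ => ⟨U, hU, h⟩
    _ ≤ ∑ U ∈ Finset.powersetCard (11 * s) (Finset.univ : Finset (Fin n)),
          ∑ A ∈ Finset.powersetCard (24 * s) (meetingTwice H U),
            selProb H n p (fun ω => ∀ c ∈ A, ω c = true) :=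
        (selProb_exists_le hp0 hp1 _ _).trans
          (Finset.sum_le_sum fun U _ => selProb_exists_le hp0 hp1 _ _)
    _ = ∑ U ∈ Finset.powersetCard (11 * s) (Finset.univ : Finset (Fin n)),
          ((meetingTwice H U).card.choose (24 * s) : ℝ) * p ^ (24 * s) := by
        refine Finset.sum_congr rfl fun U _ => ?_
        rw [← Finset.card_powersetCard, ← nsmul_eq_mul, ← Finset.sum_const]
        refine Finset.sum_congr rfl fun A hA => ?_
        rw [selProb_forall_eq, if_pos rfl, (Finset.mem_powersetCard.1 hA).2]
    _ ≤ ∑ U ∈ Finset.powersetCard (11 * s) (Finset.univ : Finset (Fin n)),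
          (40 * k * (p * mr H n 1) * (s / n)) ^ (24 * s) := by
        refine Finset.sum_le_sum fun U hU => (choose_mul_pow_le (by omega) hp0).trans ?_
        refine pow_le_pow_left₀ (by positivity) ?_ _
        obtain ⟨-, hU⟩ := Finset.mem_powersetCard.1 hU
        have h := mul_card_meetingTwice_le (H := H) U
        rw [hU] at h
        have h' : ((n : ℝ) - 1) * (meetingTwice H U).card ≤
            (11 * s) ^ 2 * (k * mr H n 1) := by
          have h2 : (((n - 1) * (meetingTwice H U).card : ℕ) : ℝ) ≤
            (((11 * s) ^ 2 * (k * mr H n 1) : ℕ) : ℝ) := by exact_mod_cast h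
          rw [Nat.cast_mul, Nat.cast_sub (by omega)] at h2
          exact_mod_cast h2
        set M : ℝ := ((meetingTwice H U).card : ℝ)
        have hM : (0 : ℝ) ≤ M := Nat.cast_nonneg _
        have h3 : n * M ≤ 242 * s ^ 2 * (k * mr H n 1) := by
          have : (n : ℝ) * M ≤ 2 * ((n - 1) * M) := by nlinarith
          linarith
        have he : Real.exp 1 ≤ 3 := by linarith [Real.exp_one_lt_d9]
        push_cast
        rw [div_le_iff₀ (by positivity)]
        have hn0 : (0 : ℝ) < n := by linarith
        refine le_of_mul_le_mul_left ?_ hn0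
        calc (n : ℝ) * (Real.exp 1 * (M * p)) = Real.exp 1 * (n * M) * p := by ring
          _ ≤ 3 * (242 * s ^ 2 * (k * mr H n 1)) * p := by gcongr
          _ = 726 * (s ^ 2 * (k * mr H n 1) * p) := by ring
          _ ≤ 960 * (s ^ 2 * (k * mr H n 1) * p) := by gcongr; norm_num
          _ = _ := by field_simp; ring
    _ = (n.choose (11 * s)) * (40 * k * (p * mr H n 1) * (s / n)) ^ (24 * s) := by
        simp
    _ ≤ _ := by
        gcongr
        exact choose_le_div_pow hs

/-- The numerical conditions on `n` under which the union bound succeeds. -/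
structure LargeEnough (k n : ℕ) : Prop where
  two_le : 2 ≤ n
  le : k ≤ n
  log_log : 24 * (k : ℝ) ≤ Real.log (Real.log n)
  log_ge : (40 * (k : ℝ)) ^ 24 ≤ Real.log n
  one_lt : 1 < Real.log n
  log_sub : 0 ≤ Real.log n - 2 * Real.log (Real.log n)
  log_le : 2 * k * Real.log n ≤ n
  exp_le : Real.log n ^ 22 * (2 ^ 11 *
    Real.exp (-((Real.log n - 2 * Real.log (Real.log n)) / (2 * k ^ 2)))) ≤ (Real.log n)⁻¹

lemma eventually_largeEnough (hk : 0 < k) : ∀ᶠ n : ℕ in atTop, LargeEnough k n := by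
  have hk' : (0 : ℝ) < k := by exact_mod_cast hk
  have hlog : Tendsto (fun n : ℕ => Real.log n) atTop atTop :=
    Real.tendsto_log_atTop.comp tendsto_natCast_atTop_atTop
  have hloglog := Real.tendsto_log_atTop.comp hlog
  have hsub : ∀ᶠ x : ℝ in atTop, 0 ≤ x - 2 * Real.log x := by
    have h := Real.isLittleO_log_id_atTop.bound (show (0 : ℝ) < 1 / 2 by norm_num)
    filter_upwards [h, eventually_ge_atTop 1] with x hx hx1
    simp only [id, Real.norm_eq_abs] at hx
    rw [abs_of_nonneg (by linarith : (0 : ℝ) ≤ x)] at hx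
    linarith [le_abs_self (Real.log x)]
  have hle : ∀ᶠ x : ℝ in atTop, 2 * k * Real.log x ≤ x := by
    have h := Real.isLittleO_log_id_atTop.bound (show (0 : ℝ) < 1 / (2 * k) by positivity)
    filter_upwards [h, eventually_ge_atTop 1] with x hx hx1
    simp only [id, Real.norm_eq_abs] at hx
    rw [abs_of_nonneg (by linarith : (0 : ℝ) ≤ x)] at hx
    have := (le_abs_self (Real.log x)).trans hx
    calc 2 * k * Real.log x ≤ 2 * k * (1 / (2 * k) * x) := by gcongr
      _ = x := by field_simp
  have hexp : ∀ᶠ x : ℝ in atTop, x ^ 22 * (2 ^ 11 *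
      Real.exp (-((x - 2 * Real.log x) / (2 * k ^ 2)))) ≤ x⁻¹ := by
    have h2 : Tendsto (fun x : ℝ => x ^ (24 : ℕ) * (x * Real.exp (-(1 / (2 * (k : ℝ) ^ 2)) * x)))
      atTop (nhds 0) := by
      have h := tendsto_rpow_mul_exp_neg_mul_atTop_nhds_zero 25 (1 / (2 * (k : ℝ) ^ 2))
        (by positivity)
      refine h.congr fun x => ?_
      rw [show (25 : ℝ) = ((25 : ℕ) : ℝ) by norm_num, Real.rpow_natCast]
      ring
    filter_upwards [h2.eventually_le_const (show (0 : ℝ) < 1 / 2 ^ 11 by positivity),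
      eventually_ge_atTop 1] with x hx hx1
    have hx0 : 0 < x := by linarith
    have hk1 : (1 : ℝ) ≤ (k : ℝ) ^ 2 := one_le_pow₀ (by exact_mod_cast hk)
    have hE : Real.exp (-((x - 2 * Real.log x) / (2 * k ^ 2))) ≤
        x * Real.exp (-(1 / (2 * (k : ℝ) ^ 2)) * x) := by
      calc _ = Real.exp (Real.log x / k ^ 2) * Real.exp (-(1 / (2 * (k : ℝ) ^ 2)) * x) := by
            rw [← Real.exp_add]; congr 1; field_simp; ring
        _ ≤ Real.exp (Real.log x) * Real.exp (-(1 / (2 * (k : ℝ) ^ 2)) * x) := by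
            gcongr
            exact div_le_self (Real.log_nonneg hx1) hk1
        _ = _ := by rw [Real.exp_log hx0]
    rw [← one_div, le_div_iff₀ hx0]
    calc _ = 2 ^ 11 * (x ^ 23 * Real.exp (-((x - 2 * Real.log x) / (2 * k ^ 2)))) := by ring
      _ ≤ 2 ^ 11 * (x ^ 24 * (x * Real.exp (-(1 / (2 * (k : ℝ) ^ 2)) * x))) := by
          gcongr
          · norm_num
      _ ≤ 2 ^ 11 * (1 / 2 ^ 11) := by gcongr
      _ = 1 := by norm_num
  filter_upwards [eventually_ge_atTop 2, eventually_ge_atTop k,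
    hloglog.eventually_ge_atTop (24 * (k : ℝ)), hlog.eventually_ge_atTop ((40 * (k : ℝ)) ^ 24),
    hlog.eventually_gt_atTop 1, hlog.eventually hsub,
    tendsto_natCast_atTop_atTop.eventually hle, hlog.eventually hexp]
    with n h1 h2 h3 h4 h5 h6 h7 h8
  exact ⟨h1, h2, h3, h4, h5, h6, h7, h8⟩

lemma LargeEnough.mr_pos (h : LargeEnough k n) (hk : 0 < k)
    (hiso : ∀ v, (H.neighborSet v).Nonempty) : (0 : ℝ) < mr H n 1 := by
  exact_mod_cast RandomMotif.mr_pos hk hiso h.le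

lemma LargeEnough.pZero_nonneg (h : LargeEnough k n) : 0 ≤ pZero H n :=
  div_nonneg h.log_sub (Nat.cast_nonneg _)

lemma LargeEnough.pZero_mul (h : LargeEnough k n) (hk : 0 < k)
    (hiso : ∀ v, (H.neighborSet v).Nonempty) :
    pZero H n * mr H n 1 = Real.log n - 2 * Real.log (Real.log n) :=
  div_mul_cancel₀ _ (h.mr_pos hk hiso).ne'

lemma LargeEnough.log_log_nonneg (h : LargeEnough k n) : 0 ≤ Real.log (Real.log n) :=
  Real.log_nonneg h.one_lt.le

lemma LargeEnough.pZero_le_one (h : LargeEnough k n) (hk : 0 < k)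
    (hiso : ∀ v, (H.neighborSet v).Nonempty) : pZero H n ≤ 1 := by
  have hk' : (0 : ℝ) < k := by exact_mod_cast hk
  have h1 := le_mul_mr hk hiso h.le h.two_le
  have hn : (2 : ℝ) ≤ n := by exact_mod_cast h.two_le
  have h2 : (n : ℝ) - 1 ≤ k * mr H n 1 := by
    have h3 : ((n - 1 : ℕ) : ℝ) ≤ ((k * mr H n 1 : ℕ) : ℝ) := by exact_mod_cast h1
    rw [Nat.cast_sub (by have := h.two_le; omega)] at h3
    exact_mod_cast h3
  have hlog : Real.log n ≤ mr H n 1 := by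
    refine le_of_mul_le_mul_left ?_ hk'
    have := h.log_le
    linarith
  rw [pZero, div_le_one (h.mr_pos hk hiso)]
  linarith [h.log_log_nonneg]

lemma LargeEnough.selProb_bad_le (h : LargeEnough k n) (hk : 0 < k)
    (hiso : ∀ v, (H.neighborSet v).Nonempty) {s : ℕ} (hs : 0 < s) (hsn : 22 * s ≤ n) :
    selProb H n (pZero H n) (Bad H n s) ≤ (Real.log n)⁻¹ ^ s := by
  have hp0 := h.pZero_nonneg (H := H)
  have hp1 := h.pZero_le_one hk hiso
  have hn : (0 : ℝ) < n := by have := h.two_le; positivity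
  have hs' : (0 : ℝ) < s := by exact_mod_cast hs
  have hl := h.one_lt
  have hl0 : 0 < Real.log n := by linarith
  by_cases hcase : (n : ℝ) / s ≤ Real.log n ^ 2
  · refine (selProb_bad_le_exp hk hp0 hp1 hs hsn).trans ?_
    rw [h.pZero_mul hk hiso]
    set a := Real.log n - 2 * Real.log (Real.log n) with ha
    calc _ = ((n / s : ℝ) ^ 11 * (2 ^ 11 * Real.exp (-(a / (2 * k ^ 2))))) ^ s := by
          rw [mul_pow, mul_pow, ← pow_mul, ← pow_mul, ← Real.exp_nat_mul]
          congr 3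
          ring
      _ ≤ ((Real.log n ^ 2) ^ 11 * (2 ^ 11 * Real.exp (-(a / (2 * k ^ 2))))) ^ s := by gcongr
      _ ≤ _ := by
          refine pow_le_pow_left₀ (by positivity) ?_ _
          rw [← pow_mul]
          exact h.exp_le
  · refine (selProb_bad_le_pow hp0 hp1 hs h.two_le).trans ?_
    rw [h.pZero_mul hk hiso]
    have ha := h.log_sub
    have ha' : Real.log n - 2 * Real.log (Real.log n) ≤ Real.log n := by
      linarith [h.log_log_nonneg]
    set a := Real.log n - 2 * Real.log (Real.log n)
    set l := Real.log n
    have hx : (s : ℝ) / n ≤ (l ^ 2)⁻¹ := by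
      rw [← inv_div]
      exact inv_anti₀ (by positivity) (not_le.1 hcase).le
    have hxx : (n : ℝ) / s * (s / n) = 1 := by field_simp
    calc _ = ((n / s : ℝ) ^ 11 * (40 * k * a * (s / n)) ^ 24) ^ s := by
          rw [mul_pow _ _ s, ← pow_mul, ← pow_mul]
      _ ≤ ((n / s : ℝ) ^ 11 * (40 * k * l * (s / n)) ^ 24) ^ s := by gcongr
      _ = ((n / s * (s / n) : ℝ) ^ 11 * ((40 * k) ^ 24 * l ^ 24 * (s / n) ^ 13)) ^ s := by ring
      _ = ((40 * k) ^ 24 * l ^ 24 * (s / n : ℝ) ^ 13) ^ s := by rw [hxx, one_pow, one_mul]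
      _ ≤ (l * l ^ 24 * ((l ^ 2)⁻¹) ^ 13) ^ s := by
          gcongr
          exact h.log_ge
      _ = _ := by
          congr 1
          field_simp

lemma LargeEnough.selProb_exists_bad_le (h : LargeEnough k n) (hk : 0 < k)
    (hiso : ∀ v, (H.neighborSet v).Nonempty) :
    selProb H n (pZero H n) (fun ω => ∃ s ∈ Finset.Icc 1 (n / 22), Bad H n s ω) ≤
      (Real.log n)⁻¹ / (1 - (Real.log n)⁻¹) := by
  have hq1 : (Real.log n)⁻¹ < 1 := inv_lt_one_of_one_lt₀ h.one_lt
  have hq0 : 0 ≤ (Real.log n)⁻¹ := inv_nonneg.2 (by linarith [h.one_lt])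
  set q := (Real.log n)⁻¹
  calc _ ≤ ∑ s ∈ Finset.Icc 1 (n / 22), selProb H n (pZero H n) (Bad H n s) :=
        selProb_exists_le h.pZero_nonneg (h.pZero_le_one hk hiso) _ _
    _ ≤ ∑ s ∈ Finset.Icc 1 (n / 22), q ^ s := by
        refine Finset.sum_le_sum fun s hs => ?_
        obtain ⟨h1, h2⟩ := Finset.mem_Icc.1 hs
        exact h.selProb_bad_le hk hiso h1 (by omega)
    _ ≤ ∑ s ∈ Finset.Ico 1 (n / 22 + 1), q ^ s := by
        rw [Finset.Ico_add_one_right_eq_Icc]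
    _ ≤ q ^ 1 / (1 - q) := geom_sum_Ico_le_of_lt_one hq0 hq1
    _ = _ := by rw [pow_one]

end Expansion

/-- **Lemma (expansion of LARGE).**  In `G(H,n,p_0)` with
`p_0 = (ln n - 2 ln ln n)/m_1(H)`, w.h.p. every `S ⊆ LARGE` with
`|S| ≤ n/(30r)` satisfies `|N(S)| ≥ 10|S|` (`r = |V(H)|`). -/
theorem expansion_of_large {r : ℕ} (H : SimpleGraph (Fin r)) (hr : 0 < r)
    (hiso : ∀ v, (H.neighborSet v).Nonempty) :
    Tendsto (fun n => selProb H n (pZero H n) (fun ω =>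
        ∀ S : Set (Fin n), S ⊆ Large ω →
          (S.ncard : ℝ) ≤ (n : ℝ) / (30 * r) →
          10 * (S.ncard : ℝ) ≤ ((extNbhd (graphOf ω) S).ncard : ℝ)))
      atTop (nhds 1) := by
  have hq : Tendsto (fun n : ℕ => (Real.log n)⁻¹) atTop (nhds 0) :=
    (Real.tendsto_log_atTop.comp tendsto_natCast_atTop_atTop).inv_tendsto_atTop
  have hlow : Tendsto (fun n : ℕ => 1 - (Real.log n)⁻¹ / (1 - (Real.log n)⁻¹)) atTop (nhds 1) := by
    simpa using tendsto_const_nhds.sub (hq.div (tendsto_const_nhds.sub hq) (by norm_num))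
  refine tendsto_of_tendsto_of_tendsto_of_le_of_le' hlow tendsto_const_nhds ?_ ?_
  · filter_upwards [eventually_largeEnough hr] with n h
    have hp0 := h.pZero_nonneg (H := H)
    have hp1 := h.pZero_le_one hr hiso
    rw [selProb_eq_one_sub]
    refine sub_le_sub_left (le_trans (selProb_mono hp0 hp1 fun ω hω => ?_)
      (h.selProb_exists_bad_le hr hiso)) 1
    push Not at hω
    obtain ⟨S, hS, hcard, hN⟩ := hω
    obtain ⟨S, rfl⟩ : ∃ T : Finset (Fin n), (T : Set (Fin n)) = S :=
      ⟨S.toFinite.toFinset, by simp⟩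
    rw [Set.ncard_coe_finset] at hcard hN
    have hN' : (extNbhd (graphOf ω) S).ncard < 10 * S.card := by exact_mod_cast hN
    have hr' : (1 : ℝ) ≤ r := by exact_mod_cast hr
    have hsn : 30 * S.card ≤ n := by
      have h1 := (le_div_iff₀ (by positivity)).1 hcard
      have h2 : (S.card : ℝ) * (30 * 1) ≤ S.card * (30 * r) := by gcongr
      have h3 : (30 * S.card : ℝ) ≤ n := by linarith
      exact_mod_cast h3
    exact ⟨S.card, Finset.mem_Icc.2 ⟨by omega, by omega⟩,
      bad_of_not_expanding hr h.log_log hS (by omega) hN'⟩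
  · filter_upwards [eventually_largeEnough hr] with n h
    rw [selProb_eq_one_sub]
    classical
    refine sub_le_self _ ?_
    unfold selProb
    refine Finset.sum_nonneg fun ω _ => mul_nonneg
      (weight_nonneg h.pZero_nonneg (h.pZero_le_one hr hiso) ω) ?_
    split_ifs <;> norm_num

end RandomMotif
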